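/- arXiv:2411.08445 — 2 statements merged into one kernel-verified Lean document; each statement's English description precedes it below -/
import Mathlib

section
/- Let a and b be effects on a complex Hilbert space H. If x, y, z are effects with a = x + y, b = x + z and y z = 0, then necessarily x = a ⩕ b, y = (a - b)⁺, z = (a - b)⁻, and x + y + z = a ⩖ b. (Here u⁺ := (|u| + u)/2 and u⁻ := (|u| - u)/2 for self-adjoint u.) -/
variable {H : Type*} [NormedAddCommGroup H] [InnerProductSpace ℂ H] [CompleteSpace H]

/-- The absolute value of a bounded operator. -/
noncomputable def oabs (u : H →L[ℂ] H) : H →L[ℂ] H := CFC.sqrt (star u * u)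

/-- A Hilbert space effect: between 0 and I in the Loewner order. -/
def IsEffect (a : H →L[ℂ] H) : Prop := 0 ≤ a ∧ a ≤ 1

/-- The operation dotWedge. -/
noncomputable def dotWedge (a b : H →L[ℂ] H) : H →L[ℂ] H :=
  ((1:ℂ)/2) • (a + b - oabs (a - b))

/-- The operation dotVee. -/
noncomputable def dotVee (a b : H →L[ℂ] H) : H →L[ℂ] H :=
  ((1:ℂ)/2) • (a + b + oabs (a - b))

/-- Effects a, b are partially ortho-coexistent. -/
def PartiallyOrthoCoexistent (a b : H →L[ℂ] H) : Prop :=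
  ∃ x y z : H →L[ℂ] H, IsEffect x ∧ IsEffect y ∧ IsEffect z ∧
    a = x + y ∧ b = x + z ∧ IsEffect (x + y + z) ∧ y * z = 0

/-- The positive part of a self-adjoint operator. -/
noncomputable def oposPart (u : H →L[ℂ] H) : H →L[ℂ] H := ((1:ℂ)/2) • (oabs u + u)

/-- The negative part of a self-adjoint operator. -/
noncomputable def onegPart (u : H →L[ℂ] H) : H →L[ℂ] H := ((1:ℂ)/2) • (oabs u - u)

/-- The absolute value of a difference of orthogonal positive operators is their sum. -/
theorem oabs_sub_of_mul_eq_zero {y z : H →L[ℂ] H} (hy : 0 ≤ y) (hz : 0 ≤ z) (hyz : y * z = 0) :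
    oabs (y - z) = y + z := by
  have hy' : star y = y := (IsSelfAdjoint.of_nonneg hy).star_eq
  have hz' : star z = z := (IsSelfAdjoint.of_nonneg hz).star_eq
  have hzy : z * y = 0 := by simpa [hy', hz'] using congrArg star hyz
  refine CFC.sqrt_unique ?_ (add_nonneg hy hz)
  simp [hy', hz', add_mul, mul_add, sub_mul, mul_sub, hyz, hzy]

theorem unique_decomposition (a b x y z : H →L[ℂ] H)
    (ha : IsEffect a) (hb : IsEffect b)
    (hx : IsEffect x) (hy : IsEffect y) (hz : IsEffect z)
    (hay : a = x + y) (hbz : b = x + z) (hyz : y * z = 0) :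
    x = dotWedge a b ∧ y = oposPart (a - b) ∧ z = onegPart (a - b) ∧
      x + y + z = dotVee a b := by
  have habs : oabs (a - b) = y + z := by
    rw [hay, hbz, add_sub_add_left_eq_sub, oabs_sub_of_mul_eq_zero hy.1 hz.1 hyz]
  simp only [dotWedge, dotVee, oposPart, onegPart, habs]
  rw [hay, hbz]
  refine ⟨?_, ?_, ?_, ?_⟩ <;> module
end

section
/- Let a and b be effects on a complex Hilbert space H, and let x₀ ∈ B(H) be positive with ‖x₀‖ < 1, commuting with both a and b. If |a - b| + |I - a - b| = I - x₀, then (1/2)x₀ ≤ a ⩕ b ≤ I - (1/2)x₀ and (1/2)x₀ ≤ a ⩖ b ≤ I - (1/2)x₀. -/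
variable {H : Type*} [NormedAddCommGroup H] [InnerProductSpace ℂ H] [CompleteSpace H]

lemma oabs_nonneg (u : H →L[ℂ] H) : 0 ≤ oabs u := CFC.sqrt_nonneg _

lemma le_oabs {u : H →L[ℂ] H} (hu : IsSelfAdjoint u) : u ≤ oabs u := by
  have h : oabs u - u = 2 • u⁻ := CFC.abs_sub_self u hu
  rw [← sub_nonneg, h]
  exact nsmul_nonneg (CFC.negPart_nonneg u) 2

lemma oabs_neg (u : H →L[ℂ] H) : oabs (-u) = oabs u := by
  simp [oabs]

lemma neg_le_oabs {u : H →L[ℂ] H} (hu : IsSelfAdjoint u) : -u ≤ oabs u := by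
  simpa [oabs_neg] using le_oabs hu.neg

lemma half_smul_nonneg {u : H →L[ℂ] H} (hu : 0 ≤ u) : 0 ≤ ((1:ℂ)/2) • u := by
  have h : ((1:ℂ)/2) • u = ((1:ℝ)/2) • u := by
    ext v
    simp [← Complex.coe_smul]
  rw [h]
  exact smul_nonneg (by norm_num) hu

theorem x0_compatible_dotWedge_dotVee_bounds (a b x₀ : H →L[ℂ] H)
    (ha : IsEffect a) (hb : IsEffect b)
    (hx₀ : 0 ≤ x₀) (hx₀n : ‖x₀‖ < 1)
    (hca : x₀ * a = a * x₀) (hcb : x₀ * b = b * x₀)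
    (h : oabs (a - b) + oabs (1 - a - b) = 1 - x₀) :
    ((1:ℂ)/2) • x₀ ≤ dotWedge a b ∧ dotWedge a b ≤ 1 - ((1:ℂ)/2) • x₀ ∧
      ((1:ℂ)/2) • x₀ ≤ dotVee a b ∧ dotVee a b ≤ 1 - ((1:ℂ)/2) • x₀ := by
  have hS : IsSelfAdjoint (1 - a - b) :=
    ((IsSelfAdjoint.one _).sub (IsSelfAdjoint.of_nonneg ha.1)).sub (IsSelfAdjoint.of_nonneg hb.1)
  have hx : x₀ = 1 - (oabs (a - b) + oabs (1 - a - b)) := by rw [h]; abel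
  have hD := oabs_nonneg (a - b)
  have hp := sub_nonneg.2 (le_oabs hS)
  have hn := sub_nonneg.2 (neg_le_oabs hS)
  unfold dotWedge dotVee
  refine ⟨?_, ?_, ?_, ?_⟩ <;> rw [← sub_nonneg]
  · convert half_smul_nonneg hp using 1
    rw [hx]; module
  · convert half_smul_nonneg (add_nonneg (add_nonneg hD hD) hn) using 1
    rw [hx]; module
  · convert half_smul_nonneg (add_nonneg (add_nonneg hD hD) hp) using 1
    rw [hx]; module
  · convert half_smul_nonneg hn using 1
    rw [hx]; module
end
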